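/- (Constant-extension estimate in the proof of Lemma 5.5) Let w : [0,1] → ℝ be Lipschitz with w(1) = 0, and define its extension w̃ on D̄ by w̃(x,y) = w(x) for 0 ≤ x ≤ 1 and w̃(x,y) = w(0) for φ(y) ≤ x < 0. Then w̃ ∈ V and 𝓔(w̃) ≤ E(w) + ε·H. In particular, inf_{v ∈ V} 𝓔(v) ≤ E(w) + ε·H for every such w. -/

import Mathlib

open MeasureTheory Set

noncomputable section

/-- The `x`-partial derivative of a function on `ℝ × ℝ`. -/
def pdx (v : ℝ × ℝ → ℝ) (p : ℝ × ℝ) : ℝ := fderiv ℝ v p (1, 0)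

/-- The `y`-partial derivative of a function on `ℝ × ℝ`. -/
def pdy (v : ℝ × ℝ → ℝ) (p : ℝ × ℝ) : ℝ := fderiv ℝ v p (0, 1)

/-- The squared norm of the (a.e.-defined) gradient `|∇v|²`. -/
def gradSq (v : ℝ × ℝ → ℝ) (p : ℝ × ℝ) : ℝ := (pdx v p) ^ 2 + (pdy v p) ^ 2

/-- The open domain `D = {(x,y) : φ(y) < x < 1, 0 < y < ε}`. -/
def Dom (ε : ℝ) (φ : ℝ → ℝ) : Set (ℝ × ℝ) :=
  {p | φ p.2 < p.1 ∧ p.1 < 1 ∧ 0 < p.2 ∧ p.2 < ε}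

/-- The closed strip `D̄ = {(x,y) : φ(y) ≤ x ≤ 1}`. -/
def DomBar (φ : ℝ → ℝ) : Set (ℝ × ℝ) := {p | φ p.2 ≤ p.1 ∧ p.1 ≤ 1}

/-- The admissible class `V`: Lipschitz functions on `D̄`, `ε`-periodic in `y`,
vanishing on `x = 1`. -/
def memV (ε : ℝ) (φ : ℝ → ℝ) (v : ℝ × ℝ → ℝ) : Prop :=
  (∃ K : NNReal, LipschitzOnWith K v (DomBar φ)) ∧
  (∀ x y : ℝ, v (x, y + ε) = v (x, y)) ∧
  (∀ y : ℝ, v (1, y) = 0)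

/-- The capillary energy functional `𝓔`. -/
def En (ε : ℝ) (φ c : ℝ → ℝ) (v : ℝ × ℝ → ℝ) : ℝ :=
  (1 / ε) * (∫ p in Dom ε φ, Real.sqrt (1 + gradSq v p)) -
  (1 / ε) * (∫ y in Ioo (0 : ℝ) ε,
    v (φ y, y) * c y * Real.sqrt (1 + (deriv φ y) ^ 2))

/-- First component of the field `∇v / √(1 + |∇v|²)`. -/
def F1 (v : ℝ × ℝ → ℝ) (p : ℝ × ℝ) : ℝ := pdx v p / Real.sqrt (1 + gradSq v p)

/-- Second component of the field `∇v / √(1 + |∇v|²)`. -/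
def F2 (v : ℝ × ℝ → ℝ) (p : ℝ × ℝ) : ℝ := pdy v p / Real.sqrt (1 + gradSq v p)

/-- A capillary solution: a member of `V`, `C²` on `D̄`, solving the minimal surface
equation in `D` and the contact-angle condition on the left boundary. -/
def IsCapillary (ε : ℝ) (φ c : ℝ → ℝ) (u : ℝ × ℝ → ℝ) : Prop :=
  memV ε φ u ∧ ContDiffOn ℝ 2 u (DomBar φ) ∧
  (∀ p ∈ Dom ε φ, pdx (F1 u) p + pdy (F2 u) p = 0) ∧
  (∀ y : ℝ, pdx u (φ y, y) - pdy u (φ y, y) * deriv φ y =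
    - c y * Real.sqrt (1 + gradSq u (φ y, y)) * Real.sqrt (1 + (deriv φ y) ^ 2))

/-- The `y`-average `v̄(x) = (1/ε) ∫₀^ε v(x,y) dy`. -/
def ybar (ε : ℝ) (v : ℝ × ℝ → ℝ) (x : ℝ) : ℝ := (1 / ε) * ∫ y in Ioo (0 : ℝ) ε, v (x, y)

/-- The cosine of the apparent contact angle,
`cos θₐ = (1/ε) ∫₀^ε c(y) √(1 + φ'(y)²) dy`. -/
def cosA (ε : ℝ) (φ c : ℝ → ℝ) : ℝ :=
  (1 / ε) * ∫ y in Ioo (0 : ℝ) ε, c y * Real.sqrt (1 + (deriv φ y) ^ 2)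

/-- The one-dimensional energy `E_β(w) = ∫₀¹ √(1 + w'(x)²) dx − β w(0)`. -/
def En1 (β : ℝ) (w : ℝ → ℝ) : ℝ :=
  (∫ x in Ioo (0 : ℝ) 1, Real.sqrt (1 + (deriv w x) ^ 2)) - w 0 * β

/-- The standard context hypotheses on the data `ε, ν, H, φ, c`. -/
def Ctx (ε ν H : ℝ) (φ c : ℝ → ℝ) : Prop :=
  ε ∈ Ioc (0 : ℝ) 1 ∧ ν ∈ Ico (0 : ℝ) 1 ∧ 0 ≤ H ∧
  ContDiff ℝ 1 φ ∧ (∀ y, φ (y + ε) = φ y) ∧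
  (∀ y, -(ε * H) ≤ φ y) ∧ (∀ y, φ y ≤ 0) ∧
  Continuous c ∧ (∀ y, c (y + ε) = c y) ∧
  (∀ y, |c y| * Real.sqrt (1 + (deriv φ y) ^ 2) ≤ ν)

/-- A Lipschitz function varies by at most the integral of `|g'|`. -/
lemma abs_sub_le_integral_abs_deriv {g : ℝ → ℝ} {a b : ℝ} {K : NNReal} (hab : a ≤ b)
    (hg : LipschitzOnWith K g (Icc a b)) :
    |g b - g a| ≤ ∫ x in Ioo a b, |deriv g x| := by
  rw [← uIcc_of_le hab] at hg
  rw [← hg.absolutelyContinuousOnInterval.integral_deriv_eq_sub,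
    intervalIntegral.integral_of_le hab, integral_Ioc_eq_integral_Ioo]
  exact abs_integral_le_integral_abs

lemma abs_le_sqrt_one_add_sq_add_sq (a b : ℝ) : |a| ≤ Real.sqrt (1 + (a ^ 2 + b ^ 2)) :=
  Real.abs_le_sqrt (by nlinarith [sq_nonneg b])

lemma isOpen_Dom (ε : ℝ) {φ : ℝ → ℝ} (hφ : Continuous φ) : IsOpen (Dom ε φ) := by
  refine (isOpen_lt (hφ.comp continuous_snd) continuous_fst).inter
    ((isOpen_lt continuous_fst continuous_const).inter
      ((isOpen_lt continuous_const continuous_snd).inter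
        (isOpen_lt continuous_snd continuous_const)))

lemma Dom_subset_DomBar (ε : ℝ) (φ : ℝ → ℝ) : Dom ε φ ⊆ DomBar φ :=
  fun _ hp => ⟨hp.1.le, hp.2.1.le⟩

lemma measure_Dom_lt_top {ε a : ℝ} {φ : ℝ → ℝ} (ha : ∀ y, a ≤ φ y) :
    volume (Dom ε φ) < ⊤ := by
  have hsub : Dom ε φ ⊆ Icc ((a, 0) : ℝ × ℝ) (1, ε) := fun p hp =>
    ⟨⟨(ha _).trans hp.1.le, hp.2.2.1.le⟩, ⟨hp.2.1.le, hp.2.2.2.le⟩⟩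
  exact (measure_mono hsub).trans_lt isCompact_Icc.measure_lt_top

/-- The area density of a Lipschitz function is integrable on `Dom ε φ`. -/
lemma integrableOn_sqrt_gradSq {ε a : ℝ} {φ : ℝ → ℝ} (hφ : Continuous φ) (ha : ∀ y, a ≤ φ y)
    {v : ℝ × ℝ → ℝ} {K : NNReal} (hv : LipschitzOnWith K v (DomBar φ)) :
    IntegrableOn (fun p => Real.sqrt (1 + gradSq v p)) (Dom ε φ) := by
  refine Measure.integrableOn_of_bounded (M := Real.sqrt (1 + ((K : ℝ) ^ 2 + (K : ℝ) ^ 2)))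
    (measure_Dom_lt_top ha).ne ?_ ?_
  · have h1 : Measurable (pdx v) := measurable_fderiv_apply_const ℝ v (1, 0)
    have h2 : Measurable (pdy v) := measurable_fderiv_apply_const ℝ v (0, 1)
    have h3 : Measurable (gradSq v) := (h1.pow_const 2).add (h2.pow_const 2)
    exact (h3.const_add 1).sqrt.aestronglyMeasurable
  · refine (ae_restrict_iff' (isOpen_Dom ε hφ).measurableSet).2 (ae_of_all _ fun p hp => ?_)
    have hn : ‖fderiv ℝ v p‖ ≤ K := norm_fderiv_le_of_lipschitzOn ℝ
      (Filter.mem_of_superset ((isOpen_Dom ε hφ).mem_nhds hp) (Dom_subset_DomBar ε φ)) hv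
    have hpd : ∀ e : ℝ × ℝ, ‖e‖ ≤ 1 → (fderiv ℝ v p e) ^ 2 ≤ (K : ℝ) ^ 2 := fun e he => by
      rw [sq_le_sq, NNReal.abs_eq]
      exact ((fderiv ℝ v p).le_of_opNorm_le_of_le hn he).trans_eq (mul_one _)
    rw [Real.norm_of_nonneg (Real.sqrt_nonneg _)]
    refine Real.sqrt_le_sqrt (add_le_add_right (add_le_add ?_ ?_) 1)
    · exact hpd (1, 0) (by simp)
    · exact hpd (0, 1) (by simp)

lemma indicator_Dom_slice (ε : ℝ) (φ : ℝ → ℝ) (f : ℝ × ℝ → ℝ) (y : ℝ) :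
    ∫ x, (Dom ε φ).indicator f (x, y) =
      (Ioo 0 ε).indicator (fun y => ∫ x in Ioo (φ y) 1, f (x, y)) y := by
  by_cases hy : y ∈ Ioo 0 ε
  · rw [indicator_of_mem hy, ← integral_indicator measurableSet_Ioo]
    congr 1 with x
    by_cases hx : x ∈ Ioo (φ y) 1
    · rw [indicator_of_mem hx, indicator_of_mem]
      exact ⟨hx.1, hx.2, hy.1, hy.2⟩
    · rw [indicator_of_notMem hx, indicator_of_notMem]
      exact fun h => hx ⟨h.1, h.2.1⟩
  · rw [indicator_of_notMem hy]
    refine integral_eq_zero_of_ae (ae_of_all _ fun x => indicator_of_notMem ?_ _)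
    exact fun h => hy ⟨h.2.2.1, h.2.2.2⟩

/-- Fubini's theorem on `Dom ε φ`, integrating in `x` first. -/
lemma setIntegral_Dom {ε : ℝ} {φ : ℝ → ℝ} (hφ : Continuous φ) {f : ℝ × ℝ → ℝ}
    (hf : IntegrableOn f (Dom ε φ)) :
    IntegrableOn (fun y => ∫ x in Ioo (φ y) 1, f (x, y)) (Ioo 0 ε) ∧
    ∫ p in Dom ε φ, f p = ∫ y in Ioo (0 : ℝ) ε, ∫ x in Ioo (φ y) 1, f (x, y) := by
  have hm := (isOpen_Dom ε hφ).measurableSet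
  have hi : Integrable ((Dom ε φ).indicator f) ((volume : Measure ℝ).prod volume) :=
    hf.integrable_indicator hm
  constructor
  · rw [← integrable_indicator_iff measurableSet_Ioo]
    exact hi.integral_prod_right.congr (ae_of_all _ (indicator_Dom_slice ε φ f))
  · rw [← integral_indicator hm, Measure.volume_eq_prod, integral_prod_symm _ hi,
      ← integral_indicator measurableSet_Ioo]
    exact integral_congr_ae (ae_of_all _ (indicator_Dom_slice ε φ f))

lemma ae_slice_differentiableAt {ε : ℝ} {φ : ℝ → ℝ} (hφ : Continuous φ)
    {v : ℝ × ℝ → ℝ} {K : NNReal} (hv : LipschitzOnWith K v (DomBar φ)) :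
    ∀ᵐ y : ℝ, ∀ᵐ x : ℝ, (x, y) ∈ Dom ε φ → DifferentiableAt ℝ v (x, y) := by
  have h : ∀ᵐ p : ℝ × ℝ, p ∈ Dom ε φ → DifferentiableAt ℝ v p := by
    filter_upwards [(hv.mono (Dom_subset_DomBar ε φ)).ae_differentiableWithinAt_of_mem
      (μ := volume)] with p hp hpD
    exact (hp hpD).differentiableAt ((isOpen_Dom ε hφ).mem_nhds hpD)
  exact Measure.ae_ae_of_ae_prod
    ((Measure.measurePreserving_swap (μ := (volume : Measure ℝ))
      (ν := (volume : Measure ℝ))).quasiMeasurePreserving.ae h)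

lemma abs_boundary_le_slice {ε a : ℝ} {φ : ℝ → ℝ} (hφ : Continuous φ) (ha : ∀ y, a ≤ φ y)
    (hφ1 : ∀ y, φ y ≤ 1) {v : ℝ × ℝ → ℝ} {K : NNReal} (hv : LipschitzOnWith K v (DomBar φ))
    (hv1 : ∀ y, v (1, y) = 0) :
    ∀ᵐ y : ℝ, y ∈ Ioo 0 ε →
      |v (φ y, y)| ≤ ∫ x in Ioo (φ y) 1, Real.sqrt (1 + gradSq v (x, y)) := by
  have hi : Integrable ((Dom ε φ).indicator fun p => Real.sqrt (1 + gradSq v p))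
      ((volume : Measure ℝ).prod volume) :=
    (integrableOn_sqrt_gradSq hφ ha hv).integrable_indicator (isOpen_Dom ε hφ).measurableSet
  filter_upwards [ae_slice_differentiableAt (ε := ε) hφ hv, hi.prod_left_ae] with y hd hint hy
  have hint' : IntegrableOn (fun x => Real.sqrt (1 + gradSq v (x, y))) (Ioo (φ y) 1) := by
    rw [← integrable_indicator_iff measurableSet_Ioo]
    refine hint.congr (ae_of_all _ fun x => ?_)
    by_cases hx : x ∈ Ioo (φ y) 1
    · rw [indicator_of_mem hx]
      exact indicator_of_mem (show (x, y) ∈ Dom ε φ from ⟨hx.1, hx.2, hy.1, hy.2⟩) _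
    · rw [indicator_of_notMem hx]
      exact indicator_of_notMem (fun h => hx ⟨h.1, h.2.1⟩) _
  have hl : LipschitzOnWith K (fun x => v (x, y)) (Icc (φ y) 1) := by
    have h := hv.comp (LipschitzWith.prodMk_right y).lipschitzOnWith
      (s := Icc (φ y) 1) (fun x hx => hx)
    rwa [mul_one] at h
  have hftc := abs_sub_le_integral_abs_deriv (hφ1 y) hl
  rw [hv1, zero_sub, abs_neg] at hftc
  refine hftc.trans (integral_mono_of_nonneg (ae_of_all _ fun x => abs_nonneg _) hint' ?_)
  filter_upwards [ae_restrict_of_ae hd, ae_restrict_mem measurableSet_Ioo] with x hx hxm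
  have hx' := hx ⟨hxm.1, hxm.2, hy.1, hy.2⟩
  have hder : HasDerivAt (fun x => v (x, y)) (pdx v (x, y)) x :=
    hx'.hasFDerivAt.comp_hasDerivAt x ((hasDerivAt_id x).prodMk (hasDerivAt_const x y))
  rw [hder.deriv]
  exact abs_le_sqrt_one_add_sq_add_sq _ _

lemma En_nonneg {ε ν H : ℝ} {φ c : ℝ → ℝ} (hctx : Ctx ε ν H φ c) {v : ℝ × ℝ → ℝ}
    (hv : memV ε φ v) : 0 ≤ En ε φ c v := by
  obtain ⟨hε, hν, -, hφ, -, hlow, hup, -, -, hcν⟩ := hctx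
  obtain ⟨⟨K, hK⟩, -, hv1⟩ := hv
  have hφc := hφ.continuous
  obtain ⟨hint, hfub⟩ := setIntegral_Dom hφc (integrableOn_sqrt_gradSq (ε := ε) hφc hlow hK)
  rw [En, ← mul_sub, hfub]
  refine mul_nonneg (one_div_nonneg.2 hε.1.le) (sub_nonneg.2 ?_)
  refine ((le_abs_self _).trans abs_integral_le_integral_abs).trans
    (integral_mono_of_nonneg (ae_of_all _ fun y => abs_nonneg _) hint ?_)
  filter_upwards [ae_restrict_of_ae (abs_boundary_le_slice (ε := ε) hφc hlow
    (fun y => (hup y).trans zero_le_one) hK hv1), ae_restrict_mem measurableSet_Ioo]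
    with y hy hym
  refine le_trans ?_ (hy hym)
  rw [mul_assoc, abs_mul, abs_mul, abs_of_nonneg (Real.sqrt_nonneg _)]
  exact mul_le_of_le_one_right (abs_nonneg _) ((hcν y).trans hν.2.le)

/-- The squared gradient of a function of `x` alone. -/
lemma gradSq_of_eventuallyEq {v : ℝ × ℝ → ℝ} {g : ℝ → ℝ} {x y : ℝ}
    (h : v =ᶠ[nhds (x, y)] fun p => g p.1) : gradSq v (x, y) = deriv g x ^ 2 := by
  rw [gradSq, pdx, pdy, h.fderiv_eq]
  by_cases hg : DifferentiableAt ℝ g x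
  · have hd : HasFDerivAt (fun p : ℝ × ℝ => g p.1)
        (deriv g x • ContinuousLinearMap.fst ℝ ℝ ℝ) (x, y) :=
      HasDerivAt.comp_hasFDerivAt (h₂ := g) (f := Prod.fst) (x, y) hg.hasDerivAt
        hasFDerivAt_fst
    simp [hd.fderiv]
  · have hn : ¬ DifferentiableAt ℝ (fun p : ℝ × ℝ => g p.1) (x, y) := fun hd => hg
      (hd.comp (f := fun t : ℝ => (t, y)) x
        (differentiableAt_id.prodMk (differentiableAt_const y)))
    simp [fderiv_zero_of_not_differentiableAt hn, deriv_zero_of_not_differentiableAt hg]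

section ConstantExtension

variable {w : ℝ → ℝ} {wt : ℝ × ℝ → ℝ}

lemma gradSq_extension_of_pos (hwt : ∀ p : ℝ × ℝ, wt p = if 0 ≤ p.1 then w p.1 else w 0)
    {x : ℝ} (hx : 0 < x) (y : ℝ) : gradSq wt (x, y) = deriv w x ^ 2 := by
  refine gradSq_of_eventuallyEq ?_
  filter_upwards [(isOpen_lt continuous_const continuous_fst).mem_nhds
    (show (0 : ℝ) < (x, y).1 from hx)] with p hp
  rw [hwt, if_pos (le_of_lt hp)]

lemma gradSq_extension_of_neg (hwt : ∀ p : ℝ × ℝ, wt p = if 0 ≤ p.1 then w p.1 else w 0)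
    {x : ℝ} (hx : x < 0) (y : ℝ) : gradSq wt (x, y) = 0 := by
  rw [gradSq_of_eventuallyEq (g := fun _ => w 0)]
  · simp
  · filter_upwards [(isOpen_lt continuous_fst continuous_const).mem_nhds
      (show (x, y).1 < (0 : ℝ) from hx)] with p hp
    rw [hwt, if_neg (not_le.2 hp)]

lemma memV_extension (hwt : ∀ p : ℝ × ℝ, wt p = if 0 ≤ p.1 then w p.1 else w 0)
    {K : NNReal} (hw : LipschitzOnWith K w (Icc (0 : ℝ) 1)) (hw1 : w 1 = 0)
    (ε : ℝ) (φ : ℝ → ℝ) : memV ε φ wt := by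
  refine ⟨⟨K, ?_⟩, fun x y => by simp [hwt], fun y => by simp [hwt, hw1]⟩
  have hmax : LipschitzWith 1 (fun p : ℝ × ℝ => max p.1 0) := LipschitzWith.prod_fst.max_const 0
  have h := hw.comp (hmax.lipschitzOnWith (s := DomBar φ))
    (fun p hp => ⟨le_max_right _ _, max_le hp.2 zero_le_one⟩)
  rw [mul_one] at h
  convert h using 1
  ext p
  rw [hwt]
  split_ifs with hp
  · simp [max_eq_left hp]
  · simp [max_eq_right (not_le.1 hp).le]

lemma slice_extension (hwt : ∀ p : ℝ × ℝ, wt p = if 0 ≤ p.1 then w p.1 else w 0)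
    {K : NNReal} (hw : LipschitzOnWith K w (Icc (0 : ℝ) 1)) {a : ℝ} (ha : a ≤ 0) (y : ℝ) :
    ∫ x in Ioo a 1, Real.sqrt (1 + gradSq wt (x, y)) =
      -a + ∫ x in Ioo (0 : ℝ) 1, Real.sqrt (1 + deriv w x ^ 2) := by
  have hint : IntegrableOn (fun x => Real.sqrt (1 + deriv w x ^ 2)) (Ioo (0 : ℝ) 1) := by
    refine Measure.integrableOn_of_bounded (M := Real.sqrt (1 + (K : ℝ) ^ 2))
      measure_Ioo_lt_top.ne
      (((measurable_deriv w).pow_const 2).const_add 1).sqrt.aestronglyMeasurable ?_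
    refine (ae_restrict_iff' measurableSet_Ioo).2 (ae_of_all _ fun x hx => ?_)
    rw [Real.norm_of_nonneg (Real.sqrt_nonneg _)]
    refine Real.sqrt_le_sqrt (add_le_add_right ?_ 1)
    rw [sq_le_sq, NNReal.abs_eq]
    exact norm_deriv_le_of_lipschitzOn (Icc_mem_nhds hx.1 hx.2) hw
  have hneg : EqOn (fun x => Real.sqrt (1 + gradSq wt (x, y))) (fun _ => 1) (Ioo a 0) :=
    fun x hx => by simp [gradSq_extension_of_neg hwt hx.2]
  have hpos : EqOn (fun x => Real.sqrt (1 + gradSq wt (x, y)))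
      (fun x => Real.sqrt (1 + deriv w x ^ 2)) (Ioo 0 1) :=
    fun x hx => by simp [gradSq_extension_of_pos hwt hx.1]
  have hInt1 : IntegrableOn (fun x => Real.sqrt (1 + gradSq wt (x, y))) (Ioc a 0) := by
    rw [integrableOn_Ioc_iff_integrableOn_Ioo]
    exact (integrableOn_const measure_Ioo_lt_top.ne).congr_fun hneg.symm measurableSet_Ioo
  have hInt2 := hint.congr_fun hpos.symm measurableSet_Ioo
  have hu : Ioo a 1 = Ioc a 0 ∪ Ioo 0 1 := (Ioc_union_Ioo_eq_Ioo ha zero_lt_one).symm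
  have hdisj : Disjoint (Ioc a 0) (Ioo (0 : ℝ) 1) :=
    Set.disjoint_left.2 fun x h1 h2 => h1.2.not_gt h2.1
  rw [hu, setIntegral_union hdisj measurableSet_Ioo hInt1 hInt2, integral_Ioc_eq_integral_Ioo,
    setIntegral_congr_fun measurableSet_Ioo hneg, setIntegral_congr_fun measurableSet_Ioo hpos]
  simp [ha]

lemma En_extension_le {ε ν H : ℝ} {φ c : ℝ → ℝ} (hctx : Ctx ε ν H φ c)
    (hwt : ∀ p : ℝ × ℝ, wt p = if 0 ≤ p.1 then w p.1 else w 0)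
    {K : NNReal} (hw : LipschitzOnWith K w (Icc (0 : ℝ) 1)) (hw1 : w 1 = 0) :
    En ε φ c wt ≤ En1 (cosA ε φ c) w + ε * H := by
  obtain ⟨hε, -, -, hφ, -, hlow, hup, -, -, -⟩ := hctx
  have hε0 : 0 < ε := hε.1
  have hφc := hφ.continuous
  obtain ⟨⟨L, hL⟩, -, -⟩ := memV_extension hwt hw hw1 ε φ
  obtain ⟨hint, hfub⟩ := setIntegral_Dom hφc (integrableOn_sqrt_gradSq (ε := ε) hφc hlow hL)
  simp only [slice_extension hwt hw (hup _)] at hint hfub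
  set A := ∫ x in Ioo (0 : ℝ) 1, Real.sqrt (1 + deriv w x ^ 2) with hA
  have hbdry : ∀ y, wt (φ y, y) * c y * Real.sqrt (1 + deriv φ y ^ 2) =
      w 0 * (c y * Real.sqrt (1 + deriv φ y ^ 2)) := fun y => by
    have : wt (φ y, y) = w 0 := by
      rw [hwt]
      split_ifs with h
      · exact congrArg w (le_antisymm (hup y) h)
      · rfl
    rw [this, mul_assoc]
  have hbulk : ∫ y in Ioo (0 : ℝ) ε, (-φ y + A) ≤ ε * (ε * H + A) := by
    calc ∫ y in Ioo (0 : ℝ) ε, (-φ y + A) ≤ ∫ _ in Ioo (0 : ℝ) ε, (ε * H + A) :=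
          integral_mono hint (integrableOn_const measure_Ioo_lt_top.ne)
            fun y => by linarith [hlow y]
      _ = ε * (ε * H + A) := by simp [hε0.le]
  have hdiv : 1 / ε * ∫ y in Ioo (0 : ℝ) ε, (-φ y + A) ≤ ε * H + A := by
    rw [one_div, inv_mul_le_iff₀ hε0]
    exact hbulk
  rw [En, En1, cosA, hfub, ← hA]
  simp only [hbdry, integral_const_mul]
  linarith

end ConstantExtension


/-- Constant-extension estimate in the proof of Lemma 5.5: the extension `w̃` of a
one-dimensional competitor `w` belongs to `V` and `𝓔(w̃) ≤ E(w) + εH`; in particular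
`inf_V 𝓔 ≤ E(w) + εH`. -/
theorem constant_extension_estimate
    (ε ν H : ℝ) (φ c : ℝ → ℝ) (hctx : Ctx ε ν H φ c)
    (w : ℝ → ℝ) (hw : ∃ K : NNReal, LipschitzOnWith K w (Icc (0 : ℝ) 1))
    (hw1 : w 1 = 0)
    (wt : ℝ × ℝ → ℝ) (hwt : ∀ p : ℝ × ℝ, wt p = if 0 ≤ p.1 then w p.1 else w 0) :
    memV ε φ wt ∧
    En ε φ c wt ≤ En1 (cosA ε φ c) w + ε * H ∧
    sInf (En ε φ c '' {v : ℝ × ℝ → ℝ | memV ε φ v}) ≤ En1 (cosA ε φ c) w + ε * H := by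
  obtain ⟨K, hK⟩ := hw
  have hmem := memV_extension hwt hK hw1 ε φ
  have hle := En_extension_le hctx hwt hK hw1
  have hbdd : BddBelow (En ε φ c '' {v : ℝ × ℝ → ℝ | memV ε φ v}) := by
    refine ⟨0, ?_⟩
    rintro _ ⟨v, hv, rfl⟩
    exact En_nonneg hctx hv
  exact ⟨hmem, hle, (csInf_le hbdd (mem_image_of_mem _ hmem)).trans hle⟩
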